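/- Let n = 2m-1 with m an integer greater than 1, and let B(s) = (b_1(s), b_2(s))^T be the Bézier curve of degree n-1 with control points Q_0 = (x_0, y_0), ..., Q_{n-1} = (x_{n-1}, y_{n-1}). Let H_x and H_y be the m×m Hankel matrices with (H_x)_{ij} = x_{i+j-2} and (H_y)_{ij} = y_{i+j-2}, and let P_m be the m×m lower triangular Pascal matrix. Define a_0, ..., a_{n-1} and b_0, ..., b_{n-1} by (P_m^{-1} H_x P_m^{-T})_{ij} = a_{i+j-2} and (P_m^{-1} H_y P_m^{-T})_{ij} = b_{i+j-2} (these matrices are Hankel, so the entries depend only on i+j). Then for all s ∈ [0,1], b_1(s) = Σ_{k=0}^{n-1} a_k binom(n-1, k) s^k and b_2(s) = Σ_{k=0}^{n-1} b_k binom(n-1, k) s^k. -/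

import Mathlib

open Matrix

/-- The `m×m` lower triangular Pascal matrix over `ℝ`. -/
def pascalMat (m : ℕ) : Matrix (Fin m) (Fin m) ℝ :=
  Matrix.of fun i j : Fin m =>
    if (j : ℕ) ≤ (i : ℕ) then ((i : ℕ).choose (j : ℕ) : ℝ) else 0

theorem pascalMat_apply {m : ℕ} (i j : Fin m) :
    pascalMat m i j = ((i : ℕ).choose (j : ℕ) : ℝ) := by
  rw [pascalMat, Matrix.of_apply]
  split_ifs with h
  · rfl
  · rw [Nat.choose_eq_zero_of_lt (not_le.mp h), Nat.cast_zero]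

theorem isUnit_det_pascalMat (m : ℕ) : IsUnit (pascalMat m).det := by
  have hdet : (pascalMat m).det = 1 := by
    rw [Matrix.det_of_isLowerTriangular]
    · simp [pascalMat_apply]
    · intro i j (hij : i < j)
      rw [pascalMat_apply, Nat.choose_eq_zero_of_lt hij, Nat.cast_zero]
  simp [hdet]

theorem eq_pascalMat_mul_mul_transpose {m : ℕ} {H A : Matrix (Fin m) (Fin m) ℝ}
    (h : (pascalMat m)⁻¹ * H * ((pascalMat m)ᵀ)⁻¹ = A) :
    H = pascalMat m * A * (pascalMat m)ᵀ := by
  have hu := isUnit_det_pascalMat m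
  have hut : IsUnit ((pascalMat m)ᵀ).det := Matrix.isUnit_det_transpose _ hu
  rw [← h, Matrix.mul_assoc, Matrix.mul_assoc, Matrix.nonsing_inv_mul _ hut, Matrix.mul_one,
    Matrix.mul_nonsing_inv_cancel_left _ _ hu]

/-- The linear functional on real polynomials sending `X ^ r` to `a r`. -/
noncomputable def momentFunctional (a : ℕ → ℝ) : Polynomial ℝ →ₗ[ℝ] ℝ :=
  Polynomial.lsum fun r => a r • LinearMap.id

theorem momentFunctional_X_pow (a : ℕ → ℝ) (r : ℕ) :
    momentFunctional a (Polynomial.X ^ r) = a r := by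
  simp [momentFunctional, Polynomial.lsum_apply, Polynomial.X_pow_eq_monomial]

theorem one_add_X_pow_eq_sum_pascalMat {m : ℕ} (i : Fin m) :
    (1 + Polynomial.X : Polynomial ℝ) ^ (i : ℕ) =
      ∑ k : Fin m, pascalMat m i k • Polynomial.X ^ (k : ℕ) := by
  ext d
  simp only [Polynomial.coeff_one_add_X_pow, Polynomial.finsetSum_coeff, Polynomial.coeff_smul,
    Polynomial.coeff_X_pow, smul_eq_mul, mul_ite, mul_one, mul_zero]
  by_cases hd : d < m
  · rw [Finset.sum_eq_single (⟨d, hd⟩ : Fin m)]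
    · simp [pascalMat_apply]
    · intro k _ hk
      rw [if_neg]
      rintro rfl
      exact hk rfl
    · simp
  · rw [Finset.sum_eq_zero]
    · rw [Nat.choose_eq_zero_of_lt (by omega), Nat.cast_zero]
    · intro k _
      rw [if_neg (by omega)]

theorem pascalMat_mul_hankel_mul_transpose_apply {m : ℕ} (a : ℕ → ℝ) (i j : Fin m) :
    (pascalMat m * (Matrix.of fun k l : Fin m => a ((k : ℕ) + (l : ℕ))) * (pascalMat m)ᵀ) i j =
      momentFunctional a ((1 + Polynomial.X) ^ ((i : ℕ) + (j : ℕ))) := by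
  rw [pow_add, one_add_X_pow_eq_sum_pascalMat i, one_add_X_pow_eq_sum_pascalMat j,
    Finset.sum_mul_sum, Finset.sum_comm]
  simp only [Matrix.mul_apply, Matrix.transpose_apply, Matrix.of_apply, map_sum, smul_mul_smul_comm,
    ← pow_add, map_smul, momentFunctional_X_pow, smul_eq_mul, Finset.sum_mul]
  refine Finset.sum_congr rfl fun l _ => Finset.sum_congr rfl fun k _ => ?_
  ring

theorem bernstein_sum_momentFunctional (a : ℕ → ℝ) (N : ℕ) (s : ℝ) :
    ∑ i ∈ Finset.range (N + 1), (N.choose i : ℝ) * s ^ i * (1 - s) ^ (N - i) *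
        momentFunctional a ((1 + Polynomial.X) ^ i) =
      ∑ k ∈ Finset.range (N + 1), a k * (N.choose k : ℝ) * s ^ k := by
  have key : ∑ i ∈ Finset.range (N + 1), ((N.choose i : ℝ) * s ^ i * (1 - s) ^ (N - i)) •
        (1 + Polynomial.X : Polynomial ℝ) ^ i =
      ∑ k ∈ Finset.range (N + 1), ((N.choose k : ℝ) * s ^ k) • Polynomial.X ^ k := by
    have e : Polynomial.C s * (1 + Polynomial.X) + Polynomial.C (1 - s) =
        Polynomial.C s * Polynomial.X + 1 := by
      simp only [map_sub, map_one]
      ring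
    have e' := (add_pow _ _ N).symm.trans ((congrArg (· ^ N) e).trans (add_pow _ _ N))
    simp only [mul_pow, one_pow] at e'
    convert e' using 2 with i _ k _
    all_goals
      simp only [Polynomial.smul_eq_C_mul, map_mul, map_pow, map_natCast]
      ring
  have h := congrArg (momentFunctional a) key
  simp only [map_sum, map_smul, momentFunctional_X_pow, smul_eq_mul] at h
  rw [h]
  exact Finset.sum_congr rfl fun k _ => by ring

theorem bezier_eq_of_pascal_hankel {m n : ℕ} (hm : 1 < m) (hn : n = 2 * m - 1) (x c : Fin n → ℝ)
    (hc : ∀ i j : Fin m,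
      ((pascalMat m)⁻¹ * (Matrix.of fun i j : Fin m => x ⟨(i : ℕ) + (j : ℕ), by omega⟩) *
        ((pascalMat m)ᵀ)⁻¹) i j = c ⟨(i : ℕ) + (j : ℕ), by omega⟩)
    (s : ℝ) :
    ∑ i : Fin n, ((n - 1).choose (i : ℕ) : ℝ) * s ^ (i : ℕ) * (1 - s) ^ (n - 1 - (i : ℕ)) * x i =
      ∑ k : Fin n, c k * ((n - 1).choose (k : ℕ) : ℝ) * s ^ (k : ℕ) := by
  obtain ⟨a, ha⟩ : ∃ a : ℕ → ℝ, ∀ k : Fin n, c k = a k :=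
    ⟨fun k => if h : k < n then c ⟨k, h⟩ else 0, fun k => by simp⟩
  have hH := eq_pascalMat_mul_mul_transpose
    (A := Matrix.of fun k l : Fin m => a ((k : ℕ) + (l : ℕ)))
    (Matrix.ext fun i j => (hc i j).trans (ha _))
  have hx : ∀ t : Fin n, x t = momentFunctional a ((1 + Polynomial.X) ^ (t : ℕ)) := by
    intro t
    obtain ⟨i, j, hij⟩ : ∃ i j : Fin m, (i : ℕ) + (j : ℕ) = t :=
      ⟨⟨min (t : ℕ) (m - 1), by omega⟩, ⟨(t : ℕ) - min (t : ℕ) (m - 1), by omega⟩, by simp⟩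
    have h := congrFun (congrFun hH i) j
    rw [pascalMat_mul_hankel_mul_transpose_apply, Matrix.of_apply] at h
    simpa only [hij] using h
  have hsum := bernstein_sum_momentFunctional a (n - 1) s
  rw [Nat.sub_add_cancel (by omega : 1 ≤ n), Finset.sum_range, Finset.sum_range] at hsum
  simpa only [hx, ha] using hsum

/-- Let `n = 2m - 1`, `m > 1`, and let `(b₁(s), b₂(s))` be the Bézier curve
with control points `(x_i, y_i)`.  With `a_k`, `b_k` defined by
`(P_m⁻¹ H_x P_m⁻ᵀ)_{ij} = a_{i+j-2}` and `(P_m⁻¹ H_y P_m⁻ᵀ)_{ij} = b_{i+j-2}`, for all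
`s ∈ [0,1]` one has `b₁(s) = ∑_k a_k C(n-1,k) s^k` and `b₂(s) = ∑_k b_k C(n-1,k) s^k`. -/
theorem bezier_pascal_coefficients
    (m : ℕ) (hm : 1 < m) (n : ℕ) (hn : n = 2 * m - 1)
    (x y : Fin n → ℝ) (ca cb : Fin n → ℝ)
    (hca : ∀ i j : Fin m,
      ((pascalMat m)⁻¹ * (Matrix.of fun i j : Fin m => x ⟨(i : ℕ) + (j : ℕ), by omega⟩) *
        ((pascalMat m)ᵀ)⁻¹) i j = ca ⟨(i : ℕ) + (j : ℕ), by omega⟩)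
    (hcb : ∀ i j : Fin m,
      ((pascalMat m)⁻¹ * (Matrix.of fun i j : Fin m => y ⟨(i : ℕ) + (j : ℕ), by omega⟩) *
        ((pascalMat m)ᵀ)⁻¹) i j = cb ⟨(i : ℕ) + (j : ℕ), by omega⟩)
    (s : ℝ) (hs : s ∈ Set.Icc (0 : ℝ) 1) :
    (∑ i : Fin n, ((n - 1).choose (i : ℕ) : ℝ) * s ^ (i : ℕ) * (1 - s) ^ (n - 1 - (i : ℕ)) * x i =
      ∑ k : Fin n, ca k * ((n - 1).choose (k : ℕ) : ℝ) * s ^ (k : ℕ)) ∧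
    (∑ i : Fin n, ((n - 1).choose (i : ℕ) : ℝ) * s ^ (i : ℕ) * (1 - s) ^ (n - 1 - (i : ℕ)) * y i =
      ∑ k : Fin n, cb k * ((n - 1).choose (k : ℕ) : ℝ) * s ^ (k : ℕ)) := by
  exact ⟨bezier_eq_of_pascal_hankel hm hn x ca hca s, bezier_eq_of_pascal_hankel hm hn y cb hcb s⟩
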